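/- arXiv:1707.09544 — 5 statements merged into one kernel-verified Lean document; each statement's English description precedes it below -/
import Mathlib

section
/- Let (A,⊏) be a finite chain and let n ≥ 2 be an integer. If ā¹, ā², …, āᵏ ∈ Aⁿ satisfy tp(ā¹) = tp(ā²) = … = tp(āᵏ), then min{mat(ā¹), mat(ā²), …, mat(āᵏ)} = mat(min{ā¹, ā², …, āᵏ}), where both minima are taken with respect to the special anti-lexicographic order ⊏_sal. -/
open scoped Classical

noncomputable section

/-! ### Basic notions: anti-lexicographic order, types, matrices,
special anti-lexicographic order, rigid surjections -/

/-- `altLex X Y` : the anti-lexicographic order `⊏_alex` on subsets of a chain,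
comparing characteristic vectors anti-lexicographically (`0 < 1`), i.e. the
`⊏`-largest element on which `X` and `Y` differ belongs to `Y`. -/
def altLex {A : Type*} [LinearOrder A] (X Y : Finset A) : Prop :=
  ∃ m, m ∈ Y ∧ m ∉ X ∧ ∀ z, m < z → (z ∈ X ↔ z ∈ Y)

/-- The `≡_σ`-equivalence class of `i` within `{0, …, n-1}`, for a
(total quasi)order `σ` on `{0, …, n-1}`. -/
def classOf (σ : ℕ → ℕ → Prop) (n i : ℕ) : Finset ℕ :=
  (Finset.range n).filter fun j => σ i j ∧ σ j i

/-- The set of `≡_σ`-equivalence classes. -/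
def classesOf (σ : ℕ → ℕ → Prop) (n : ℕ) : Finset (Finset ℕ) :=
  (Finset.range n).image (classOf σ n)

/-- `σ ◁ τ` : the linear order on total quasiorders on `{0, …, n-1}` : `σ ◁ τ` if `σ`
has fewer classes, or they have equally many classes and the tuples of classes, each
listed in `<_alex`-increasing order, compare anti-lexicographically w.r.t. `<_alex`
(for such increasing enumerations of two families of sets this amounts to: the
`<_alex`-largest class in which the two families differ belongs to the family of
classes of `τ`). -/
def quasiLT (n : ℕ) (σ τ : ℕ → ℕ → Prop) : Prop :=
  (classesOf σ n).card < (classesOf τ n).card ∨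
    ((classesOf σ n).card = (classesOf τ n).card ∧
      ∃ M, M ∈ classesOf τ n ∧ M ∉ classesOf σ n ∧
        ∀ X, altLex M X → (X ∈ classesOf σ n ↔ X ∈ classesOf τ n))

/-- `IsTotalQuasiorder n σ` : `σ` is a total quasiorder on `{0, …, n-1}`. -/
def IsTotalQuasiorder (n : ℕ) (σ : ℕ → ℕ → Prop) : Prop :=
  (∀ i j, σ i j → i < n ∧ j < n) ∧ (∀ i < n, σ i i) ∧
    (∀ i j k, σ i j → σ j k → σ i k) ∧ ∀ i j, i < n → j < n → σ i j ∨ σ j i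

/-- The type `tp(ā)` of a tuple (represented as a list): the total quasiorder
`{(i,j) : a_i ⊑ a_j}` on the set of positions of the list. -/
def tpRel {A : Type*} [LinearOrder A] (l : List A) : ℕ → ℕ → Prop :=
  fun i j => ∃ (hi : i < l.length) (hj : j < l.length), l.get ⟨i, hi⟩ ≤ l.get ⟨j, hj⟩

/-- The special anti-lexicographic order `⊏_sal` on tuples (represented as lists):
`ā ⊏_sal b̄` iff `tp(ā) ◁ tp(b̄)`, or the types coincide, the sets of entries
differ and the set of entries of `ā` is `⊏_alex`-below that of `b̄`. -/
def salLT {A : Type*} [LinearOrder A] (l₁ l₂ : List A) : Prop :=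
  l₁.length = l₂.length ∧
    (quasiLT l₁.length (tpRel l₁) (tpRel l₂) ∨
      (tpRel l₁ = tpRel l₂ ∧ l₁.toFinset ≠ l₂.toFinset ∧ altLex l₁.toFinset l₂.toFinset))

/-- The matrix `mat(ā)` of a tuple: the `⊏`-increasing enumeration of its set of
entries (one representative from each `≡_{tp(ā)}`-class, in increasing order). -/
def matL {A : Type*} [LinearOrder A] (l : List A) : List A :=
  l.toFinset.sort (· ≤ ·)

/-- The number of `≡_σ`-classes strictly `≺_σ`-below the class of `i`. -/
def classRank (σ : ℕ → ℕ → Prop) (n i : ℕ) : ℕ :=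
  (((Finset.range n).filter fun j => σ j i ∧ ¬ σ i j).image (classOf σ n)).card

/-- `tup σ n b` : the `n`-tuple obtained by placing the `ξ`-th entry of `b` on all
coordinates belonging to the `ξ`-th `≡_σ`-class (classes enumerated in the
`≺_σ`-increasing order). -/
def tup {A : Type*} [Nonempty A] (σ : ℕ → ℕ → Prop) (n : ℕ) (b : List A) : List A :=
  (List.range n).map fun i => b.getD (classRank σ n i) (Classical.arbitrary A)

/-- `m` is the minimum of `S` with respect to a strict order `lt`. -/
def MinWrt {α : Type*} (lt : α → α → Prop) (S : Set α) (m : α) : Prop :=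
  m ∈ S ∧ ∀ x ∈ S, x = m ∨ lt m x

/-- `f` maps `S` onto `T` and is rigid w.r.t. the strict orders `ltA`, `ltB`:
minima of preimages of `ltB`-comparable elements are `ltA`-comparable in the
same order. -/
def IsRigidSurjOn {α β : Type*} (ltA : α → α → Prop) (ltB : β → β → Prop)
    (S : Set α) (T : Set β) (f : α → β) : Prop :=
  (∀ a ∈ S, f a ∈ T) ∧ (∀ b ∈ T, ∃ a ∈ S, f a = b) ∧
    ∀ x ∈ T, ∀ y ∈ T, ltB x y → ∀ a b, MinWrt ltA {u | u ∈ S ∧ f u = x} a →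
      MinWrt ltA {u | u ∈ S ∧ f u = y} b → ltA a b

/-- A rigid surjection between chains: a surjection such that
`min f⁻¹(x) ⊏ min f⁻¹(y)` whenever `x ⊏' y`. -/
def IsRigidSurjection {A B : Type*} [LinearOrder A] [LinearOrder B] (f : A → B) : Prop :=
  Function.Surjective f ∧ ∀ x y : B, x < y → ∀ a b : A,
    IsLeast {u | f u = x} a → IsLeast {v | f v = y} b → a < b

/-! ### The dual Ramsey property for a class of objects with
designated surjective morphisms.

`C ⟶ (B)^A_k` in `C^op` unfolds to: for every `k`-colouring `χ` of the
morphisms `C → A` there are `w : C → B` and a colour `i` such that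
`χ(g ∘ w) = i` for every morphism `g : B → A`.  -/

/-- The dual Ramsey property for the (full) subcategory spanned by `S` of the category
whose objects are `Obj` and whose morphisms `X → Y` are the functions
`carrier X → carrier Y` satisfying `IsMor X Y`. -/
def HasDualRamseySub {Obj : Type*} (carrier : Obj → Type*)
    (IsMor : ∀ X Y : Obj, (carrier X → carrier Y) → Prop) (S : Set Obj) : Prop :=
  ∀ k : ℕ, 2 ≤ k → ∀ A ∈ S, ∀ B ∈ S, (∃ f : carrier B → carrier A, IsMor B A f) →
    ∃ C ∈ S, ∀ χ : (carrier C → carrier A) → Fin k,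
      ∃ w : carrier C → carrier B, IsMor C B w ∧ ∃ i : Fin k,
        ∀ g : carrier B → carrier A, IsMor B A g → χ (g ∘ w) = i

/-- The dual Ramsey property for the category whose objects are `Obj` and whose
morphisms `X → Y` are the functions `carrier X → carrier Y` satisfying `IsMor X Y`. -/
def HasDualRamseyClass {Obj : Type*} (carrier : Obj → Type*)
    (IsMor : ∀ X Y : Obj, (carrier X → carrier Y) → Prop) : Prop :=
  HasDualRamseySub carrier IsMor Set.univ

end

theorem not_altLex_of_altLex {A : Type*} [LinearOrder A] {X Y : Finset A}
    (h : altLex X Y) : ¬ altLex Y X := by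
  rintro ⟨q, hqX, hqY, hq⟩
  obtain ⟨p, hpY, hpX, hp⟩ := h
  rcases lt_trichotomy p q with h | h | h
  · exact hqY ((hp q h).1 hqX)
  · exact hpX (h ▸ hqX)
  · exact hpX ((hq p h).1 hpY)

theorem not_quasiLT_self (n : ℕ) (σ : ℕ → ℕ → Prop) : ¬ quasiLT n σ σ := by
  rintro (h | ⟨-, M, hM, hM', -⟩)
  · exact lt_irrefl _ h
  · exact hM' hM

theorem altLex_toFinset_of_salLT {A : Type*} [LinearOrder A] {l₁ l₂ : List A}
    (htp : tpRel l₁ = tpRel l₂) (h : salLT l₁ l₂) : altLex l₁.toFinset l₂.toFinset := by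
  rcases h with ⟨-, h | h⟩
  · exact absurd (htp ▸ h) (not_quasiLT_self _ _)
  · exact h.2.2

theorem tpRel_matL_iff {A : Type*} [LinearOrder A] (l : List A) (i j : ℕ) :
    tpRel (matL l) i j ↔ i < (matL l).length ∧ j < (matL l).length ∧ i ≤ j := by
  have hs : StrictMono (matL l).get := (Finset.sortedLT_sort l.toFinset).strictMono_get
  constructor
  · rintro ⟨hi, hj, h⟩
    exact ⟨hi, hj, hs.le_iff_le.1 h⟩
  · rintro ⟨hi, hj, h⟩
    exact ⟨hi, hj, hs.le_iff_le.2 h⟩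

theorem tpRel_matL_eq_of_length_eq {A : Type*} [LinearOrder A] {l₁ l₂ : List A}
    (h : (matL l₁).length = (matL l₂).length) : tpRel (matL l₁) = tpRel (matL l₂) := by
  ext i j
  rw [tpRel_matL_iff, tpRel_matL_iff, h]

theorem toFinset_matL {A : Type*} [LinearOrder A] (l : List A) :
    (matL l).toFinset = l.toFinset :=
  Finset.sort_toFinset _ _

/-- Lemma 2.3 (c). Let `(A,⊏)` be a finite chain and `n ≥ 2`.
If `ā¹, …, āᵏ ∈ Aⁿ` all have the same type, then
`min{mat(ā¹), …, mat(āᵏ)} = mat(min{ā¹, …, āᵏ})`, both minima taken w.r.t. `⊏_sal`. -/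
theorem stmt2 {A : Type*} [Fintype A] [LinearOrder A] (n k : ℕ) (hn : 2 ≤ n) (hk : 1 ≤ k)
    (a : Fin k → List A) (hlen : ∀ i, (a i).length = n)
    (htp : ∀ i j, tpRel (a i) = tpRel (a j))
    (m : List A) (hm : MinWrt salLT {l | ∃ i, l = a i} m)
    (m' : List A) (hm' : MinWrt salLT {l | ∃ i, l = matL (a i)} m') :
    m' = matL m := by
  obtain ⟨⟨j, rfl⟩, hmin⟩ := hm
  obtain ⟨⟨i, rfl⟩, hmin'⟩ := hm'
  rcases hmin (a i) ⟨i, rfl⟩ with h | h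
  · rw [h]
  rcases hmin' (matL (a j)) ⟨j, rfl⟩ with h' | h'
  · exact h'.symm
  have hmat := altLex_toFinset_of_salLT (tpRel_matL_eq_of_length_eq h'.1) h'
  rw [toFinset_matL, toFinset_matL] at hmat
  exact absurd hmat (not_altLex_of_altLex (altLex_toFinset_of_salLT (htp j i) h))
end

section
/- Let C be a category in which every morphism is an epimorphism. If C has the dual Ramsey property, then every object of C is rigid, i.e., the only invertible morphism in hom_C(A,A) is the identity, for every object A. -/
open CategoryTheory

/-- `RamseyArrow k A B X` : `X ⟶ (B)^A_k`, i.e. for every `k`-colouring of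
`hom(A,X)` there is a morphism `w : B ⟶ X` and a colour `i` such that
`w · hom(A,B)` is `i`-monochromatic. -/
def RamseyArrow {C : Type*} [Category C] (k : ℕ) (A B X : C) : Prop :=
  ∀ χ : (A ⟶ X) → Fin k, ∃ w : B ⟶ X, ∃ i : Fin k, ∀ g : A ⟶ B, χ (g ≫ w) = i

/-- A category has the Ramsey property if for every `k ≥ 2` and all objects `A`, `B`
with `hom(A,B) ≠ ∅` there is an object `X` with `X ⟶ (B)^A_k`. -/
def HasRamsey (C : Type*) [Category C] : Prop :=
  ∀ k : ℕ, 2 ≤ k → ∀ A B : C, Nonempty (A ⟶ B) → ∃ X : C, RamseyArrow k A B X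

/-- A category has the dual Ramsey property if its opposite has the Ramsey property. -/
def HasDualRamsey (C : Type*) [Category C] : Prop :=
  HasRamsey Cᵒᵖ

/-- Two morphisms into `A` are related when they differ by an automorphism of `A`. -/
def autOrbitSetoid {C : Type*} [Category C] (X A : C) : Setoid (X ⟶ A) where
  r u v := ∃ e : A ≅ A, u ≫ e.hom = v
  iseqv :=
    { refl := fun u => ⟨Iso.refl A, Category.comp_id u⟩
      symm := by
        rintro u v ⟨e, rfl⟩
        exact ⟨e.symm, by simp⟩
      trans := by
        rintro u v w ⟨e, rfl⟩ ⟨e', rfl⟩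
        exact ⟨e ≪≫ e', by simp⟩ }

/-- Corollary 3.3. Let `C` be a category in which every morphism is
epi. If `C` has the dual Ramsey property then every object of `C` is rigid: the only
invertible morphism `A ⟶ A` is the identity. -/
theorem stmt7 {C : Type*} [Category C] (hepi : ∀ {X Y : C} (f : X ⟶ Y), Epi f)
    (h : HasDualRamsey C) :
    ∀ (A : C) (f : A ⟶ A), IsIso f → f = 𝟙 A := by
  classical
  intro A f hf
  obtain ⟨X, hX⟩ := h 2 le_rfl (.op A) (.op A) ⟨𝟙 _⟩
  let rep (u : X.unop ⟶ A) : X.unop ⟶ A := (Quotient.mk (autOrbitSetoid X.unop A) u).out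
  -- Colour exactly the chosen representative of each orbit by `0`.
  obtain ⟨w, i, hw⟩ := hX fun φ => if φ.unop = rep φ.unop then 0 else 1
  have rep_comp (u : X.unop ⟶ A) (e : A ≅ A) : rep (u ≫ e.hom) = rep u :=
    congrArg Quotient.out (Quotient.sound (s := autOrbitSetoid X.unop A) ⟨e, rfl⟩).symm
  obtain ⟨e, he⟩ : ∃ e : A ≅ A, w.unop ≫ e.hom = rep w.unop :=
    (autOrbitSetoid X.unop A).symm (Quotient.mk_out (s := autOrbitSetoid X.unop A) w.unop)
  have h₀ := hw e.hom.op
  have h₁ := hw (e ≪≫ asIso f).hom.op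
  simp only [unop_comp, Quiver.Hom.unop_op, rep_comp] at h₀ h₁
  rw [if_pos he] at h₀
  have hfix : w.unop ≫ (e ≪≫ asIso f).hom = rep w.unop := by
    by_contra hne
    rw [if_neg hne, ← h₀] at h₁
    exact absurd h₁ (by decide)
  have := hepi (rep w.unop)
  rw [← cancel_epi (rep w.unop), Category.comp_id]
  simpa [← Category.assoc, he] using hfix
end

section
/- Let C be a full subcategory of OBin_rsh such that Ob(C) contains an infinite subsequence of the empty linearly ordered reflexive binary relational structures E₁, E₂, E₃, …, Eₙ, …. Then C has the dual Ramsey property. -/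
open scoped Classical

noncomputable section

/-- A finite linearly ordered reflexive binary relational structure. -/
structure OBinObj where
  carrier : Type
  [fintypeI : Fintype carrier]
  [linearOrderI : LinearOrder carrier]
  rel : carrier → carrier → Prop
  refl : ∀ x, rel x x

attribute [instance] OBinObj.fintypeI OBinObj.linearOrderI

/-- Rigid surjective homomorphisms: the morphisms of `OBin_rsh`. -/
def IsRSH (M N : OBinObj) (f : M.carrier → N.carrier) : Prop :=
  (∀ x y, M.rel x y → N.rel (f x) (f y)) ∧ IsRigidSurjection f

/-- `Eₙ` : the empty linearly ordered reflexive binary relational structure on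
`n` vertices. -/
def Estruct (n : ℕ) : OBinObj where
  carrier := Fin n
  rel := fun x y => x = y
  refl := fun _ => rfl

/-- `RigidWord a b l`: the entries of `l` are below `b`, and the letters `a, a + 1, …, b - 1`
all occur in `l`, in this order of first occurrence. These are the `(b - a)`-parameter words over
an alphabet of size `a`. -/
inductive RigidWord : ℕ → ℕ → List ℕ → Prop
  | nil (a : ℕ) : RigidWord a a []
  | old {a b x : ℕ} {l : List ℕ} : x < a → RigidWord a b l → RigidWord a b (x :: l)
  | new {a b : ℕ} {l : List ℕ} : RigidWord (a + 1) b l → RigidWord a b (a :: l)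

namespace RigidWord

variable {a b c : ℕ} {u v w : List ℕ}

theorem le (h : RigidWord a b w) : a ≤ b := by
  induction h <;> omega

theorem lt_of_mem (h : RigidWord a b w) : ∀ x ∈ w, x < b := by
  induction h with
  | nil => simp
  | old hx h ih =>
    have := h.le
    simp only [List.mem_cons, forall_eq_or_imp]
    exact ⟨by omega, ih⟩
  | new h ih =>
    have := h.le
    simp only [List.mem_cons, forall_eq_or_imp]
    exact ⟨by omega, ih⟩

theorem of_forall_lt (h : ∀ x ∈ w, x < a) : RigidWord a a w := by
  induction w with
  | nil => exact .nil a
  | cons x w ih =>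
    simp only [List.mem_cons, forall_eq_or_imp] at h
    exact .old h.1 (ih h.2)

theorem append (hu : RigidWord a b u) (hv : RigidWord b c v) : RigidWord a c (u ++ v) := by
  induction hu with
  | nil => exact hv
  | old hx _ ih => exact .old hx (ih hv)
  | new _ ih => exact .new (ih hv)

theorem append_zeros (ha : 0 < a) (h : RigidWord a b w) (n : ℕ) :
    RigidWord a b (w ++ List.replicate n 0) := by
  refine h.append (of_forall_lt fun x hx => ?_)
  have := h.le
  rw [List.eq_of_mem_replicate hx]
  omega

theorem range' (a m : ℕ) : RigidWord a (a + m) (List.range' a m) := by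
  induction m generalizing a with
  | zero => exact .nil a
  | succ m ih =>
    rw [List.range'_succ]
    have := ih (a + 1)
    rw [Nat.add_right_comm] at this
    exact .new this

theorem exists_split (h : RigidWord a b w) {x : ℕ} (hax : a ≤ x) (hxb : x < b) :
    ∃ u v, w = u ++ x :: v ∧ RigidWord a x u ∧ RigidWord (x + 1) b v := by
  induction h with
  | nil => omega
  | @old a b y l hy h ih =>
    obtain ⟨u, v, rfl, hu, hv⟩ := ih hax hxb
    exact ⟨y :: u, v, rfl, .old hy hu, hv⟩
  | @new a b l h ih =>
    rcases hax.eq_or_lt with rfl | hlt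
    · exact ⟨[], l, rfl, .nil a, h⟩
    · obtain ⟨u, v, rfl, hu, hv⟩ := ih hlt hxb
      exact ⟨a :: u, v, rfl, .new hu, hv⟩

theorem map {s : ℕ} {φ : ℕ → ℕ} (hw : RigidWord a b w) (hφ : ∀ x < a, φ x < s)
    (h : RigidWord s c ((List.range' a (b - a)).map φ)) : RigidWord s c (w.map φ) := by
  induction hw generalizing s with
  | nil => simpa using h
  | old hx _ ih => exact .old (hφ _ hx) (ih hφ h)
  | @new a b l hl ih =>
    have hab : b - a = (b - (a + 1)) + 1 := by have := hl.le; omega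
    rw [hab, List.range'_succ, List.map_cons] at h
    rw [List.map_cons]
    have key : ∀ {y : ℕ} {L : List ℕ}, φ a = y → RigidWord s c (y :: L) →
        L = (List.range' (a + 1) (b - (a + 1))).map φ → RigidWord s c (y :: l.map φ) := by
      intro y L hy hL hLe
      cases hL with
      | old hys hL =>
        refine .old hys (ih (fun x hx => ?_) (hLe ▸ hL))
        rcases Nat.lt_succ_iff_lt_or_eq.1 hx with h | rfl
        · exact hφ x h
        · exact hy ▸ hys
      | new hL =>
        refine .new (ih (fun x hx => ?_) (hLe ▸ hL))
        rcases Nat.lt_succ_iff_lt_or_eq.1 hx with h | rfl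
        · exact (hφ x h).trans s.lt_succ_self
        · omega
    exact key rfl h rfl

theorem of_first_occurrences (hab : a ≤ b) (hmem : ∀ y, a ≤ y → y < b → y ∈ w)
    (hocc : ∀ u x v, w = u ++ x :: v → x < b ∧ ∀ y, a ≤ y → y < x → y ∈ u) :
    RigidWord a b w := by
  induction w generalizing a with
  | nil =>
    obtain rfl : a = b := by
      by_contra hne
      simpa using hmem a le_rfl (by omega)
    exact .nil a
  | cons x w ih =>
    obtain ⟨hxb, hx⟩ := hocc [] x w rfl
    have hxa : x ≤ a := by
      by_contra! hlt
      simpa using hx a le_rfl hlt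
    rcases hxa.lt_or_eq with hlt | rfl
    · refine .old hlt (ih hab (fun y hy hyb => ?_) fun u z v huv => ?_)
      · exact (List.mem_cons.1 (hmem y hy hyb)).resolve_left (by omega)
      · refine ⟨(hocc (x :: u) z v (by simp [huv])).1, fun y hy hyz => ?_⟩
        exact (List.mem_cons.1 ((hocc (x :: u) z v (by simp [huv])).2 y hy hyz)).resolve_left
          (by omega)
    · refine .new (ih hxb (fun y hy hyb => ?_) fun u z v huv => ?_)
      · exact (List.mem_cons.1 (hmem y (by omega) hyb)).resolve_left (by omega)
      · refine ⟨(hocc (x :: u) z v (by simp [huv])).1, fun y hy hyz => ?_⟩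
        exact (List.mem_cons.1
          ((hocc (x :: u) z v (by simp [huv])).2 y (by omega) hyz)).resolve_left (by omega)

theorem takeWhile_append_cons (h : RigidWord a b u) :
    (u ++ b :: v).takeWhile (· < b) = u := by
  rw [List.takeWhile_append_of_pos (by simpa using h.lt_of_mem)]
  simp

end RigidWord

/-- Letters below `a` stay fixed, the letter `a + i` becomes the `i`-th entry of `g`. -/
def letterSubst (a : ℕ) (g : List ℕ) (x : ℕ) : ℕ :=
  if x < a then x else g.getD (x - a) 0

/-- The word obtained from `w` by substituting the entries of `g` for the letters
`a, a + 1, …`. -/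
def wordSubst (a : ℕ) (w g : List ℕ) : List ℕ :=
  w.map (letterSubst a g)

section Substitution

variable {a b c m : ℕ} {g p q u v w : List ℕ}

theorem letterSubst_of_lt {x : ℕ} (h : x < a) : letterSubst a g x = x :=
  if_pos h

theorem letterSubst_add (i : ℕ) : letterSubst a g (a + i) = g.getD i 0 := by
  simp [letterSubst]

@[simp]
theorem length_wordSubst : (wordSubst a w g).length = w.length :=
  List.length_map _

theorem wordSubst_append : wordSubst a (u ++ v) g = wordSubst a u g ++ wordSubst a v g :=
  List.map_append

theorem map_letterSubst_range' (i : ℕ) (h : p.length = i) :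
    (List.range' (a + i) q.length).map (letterSubst a (p ++ q)) = q := by
  refine List.ext_getElem (by simp) fun n h₁ h₂ => ?_
  simp only [List.getElem_map, List.getElem_range', one_mul]
  rw [add_assoc, letterSubst_add, List.getD_eq_getElem _ _ (by simp; omega),
    List.getElem_append_right (by omega)]
  simp [h]

theorem wordSubst_range'_append : wordSubst a (List.range' a p.length) (p ++ q) = p := by
  refine List.ext_getElem (by simp) fun n h₁ h₂ => ?_
  simp only [wordSubst, List.getElem_map, List.getElem_range', one_mul]
  rw [letterSubst_add, List.getD_eq_getElem _ _ (by simp; omega), List.getElem_append_left]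

theorem wordSubst_range' : wordSubst a (List.range' a p.length) p = p := by
  simpa using wordSubst_range'_append (a := a) (p := p) (q := [])

theorem wordSubst_append_right (hw : ∀ x ∈ w, x < a + p.length) :
    wordSubst a w (p ++ q) = wordSubst a w p := by
  refine List.map_congr_left fun x hx => ?_
  have := hw x hx
  unfold letterSubst
  split_ifs
  · rfl
  · exact List.getD_append _ _ _ _ (by omega)

theorem wordSubst_assoc (hw : ∀ x ∈ w, x < a + v.length) :
    wordSubst a (wordSubst a w v) g = wordSubst a w (wordSubst a v g) := by
  rw [wordSubst, wordSubst, List.map_map]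
  refine List.map_congr_left fun x hx => ?_
  have := hw x hx
  rcases lt_or_ge x a with h | h
  · simp [letterSubst_of_lt h]
  · obtain ⟨i, rfl⟩ := Nat.exists_eq_add_of_le h
    rw [Function.comp_apply, letterSubst_add, letterSubst_add,
      List.getD_eq_getElem _ _ (by omega), List.getD_eq_getElem _ _ (by simp; omega)]
    simp [wordSubst]

theorem RigidWord.wordSubst (hw : RigidWord a (a + g.length) w) (hg : RigidWord a c g) :
    RigidWord a c (wordSubst a w g) := by
  refine hw.map (fun x hx => by rwa [letterSubst_of_lt hx]) ?_
  have := wordSubst_range' (a := a) (p := g)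
  unfold _root_.wordSubst at this
  rwa [Nat.add_sub_cancel_left, this]

/-- The part of `wordSubst a w g` before the first occurrence of `a` only depends on the
corresponding part of `g`. -/
theorem exists_wordSubst_split (hu : RigidWord a (a + p.length) u)
    (hv : RigidWord (a + p.length + 1) (a + (p ++ a :: q).length) v)
    (hp : RigidWord a a p) (hq : RigidWord (a + 1) c q) :
    ∃ r, wordSubst a (u ++ (a + p.length) :: v) (p ++ a :: q) = wordSubst a u p ++ a :: r ∧
      RigidWord (a + 1) c r := by
  refine ⟨wordSubst a v (p ++ a :: q), ?_, ?_⟩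
  · rw [wordSubst_append, wordSubst_append_right hu.lt_of_mem]
    simp [wordSubst, letterSubst_add]
  · refine hv.map (fun x hx => ?_) ?_
    · rcases lt_or_ge x a with h | h
      · rw [letterSubst_of_lt h]; omega
      · obtain ⟨i, rfl⟩ := Nat.exists_eq_add_of_le h
        rw [letterSubst_add]
        rcases (show i ≤ p.length by omega).lt_or_eq with hi | rfl
        · rw [List.getD_append _ _ _ _ hi, List.getD_eq_getElem _ _ hi]
          exact (hp.lt_of_mem _ (List.getElem_mem hi)).trans a.lt_succ_self
        · simp
    · have := map_letterSubst_range' (a := a) (p := p ++ [a]) (q := q) (p.length + 1) (by simp)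
      simp only [List.append_assoc, List.singleton_append] at this
      rw [show a + (p ++ a :: q).length - (a + p.length + 1) = q.length by simp; omega,
        add_assoc, this]
      exact hq

end Substitution

theorem finite_words (a m : ℕ) : Finite {l : List ℕ // l.length = m ∧ RigidWord a a l} := by
  have h : {l : List ℕ | l.length = m ∧ RigidWord a a l} ⊆
      List.map Fin.val '' {l : List (Fin a) | l.length = m} := by
    rintro l ⟨hl, hw⟩
    refine ⟨l.pmap Fin.mk hw.lt_of_mem, by simpa using hl, ?_⟩
    simp [List.map_pmap]
  exact ((List.finite_length_eq (Fin a) m).image _ |>.subset h).to_subtype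

/-- The Graham–Rothschild property for colourings of `t`-parameter words by `κ`, with
monochromatic `m`-parameter words over an alphabet of size `a`. -/
def GrahamRothschild (a m t : ℕ) (κ : Type) : Prop :=
  ∃ N, ∀ χ : List ℕ → κ, ∃ w : List ℕ, w.length = N ∧ RigidWord a (a + m) w ∧
    ∃ i, ∀ g : List ℕ, g.length = m → RigidWord a (a + t) g → χ (wordSubst a w g) = i

/-- The multidimensional Hales–Jewett theorem with ordered parameters. -/
theorem grahamRothschild_zero (a m : ℕ) (κ : Type) [Finite κ] : GrahamRothschild a m 0 κ := by
  have := finite_words a m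
  obtain ⟨ι, _, hι⟩ := Combinatorics.Line.exists_mono_in_high_dimension
    {l : List ℕ // l.length = m ∧ RigidWord a a l} κ
  let is : List ι := Finset.univ.toList
  refine ⟨Fintype.card ι * m, fun χ => ?_⟩
  obtain ⟨l, k, hl⟩ := hι fun f => χ (is.flatMap fun i => (f i : List ℕ))
  let block (i : ι) : List ℕ := ((l.idxFun i).map Subtype.val).getD (List.range' a m)
  have hlen (i : ι) : (block i).length = m := by
    rcases h : l.idxFun i with _ | x
    · simp [block, h]
    · simpa [block, h] using x.2.1
  have hlt (i : ι) : ∀ x ∈ block i, x < a + m := by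
    rcases h : l.idxFun i with _ | y
    · simp [block, h]
    · intro x hx
      have := y.2.2.lt_of_mem x (by simpa [block, h] using hx)
      omega
  have hrigid (js : List ι) (hjs : ∃ i ∈ js, l.idxFun i = none) :
      RigidWord a (a + m) (js.flatMap block) := by
    induction js with
    | nil => simp at hjs
    | cons j js ih =>
      rw [List.flatMap_cons]
      rcases h : l.idxFun j with _ | y
      · have hj : block j = List.range' a m := by simp [block, h]
        rw [hj]
        refine (RigidWord.range' a m).append (RigidWord.of_forall_lt fun x hx => ?_)
        obtain ⟨i, -, hi⟩ := List.mem_flatMap.1 hx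
        exact hlt i x hi
      · have hj : block j = y := by simp [block, h]
        rw [hj]
        refine y.2.2.append (ih ?_)
        obtain ⟨i, hi, hn⟩ := hjs
        rcases List.mem_cons.1 hi with rfl | hi
        · simp [h] at hn
        · exact ⟨i, hi, hn⟩
  refine ⟨is.flatMap block, ?_, hrigid is ?_, k, fun g hg hgw => ?_⟩
  · simp [List.length_flatMap, hlen, is]
  · obtain ⟨i, hi⟩ := l.proper
    exact ⟨i, by simp [is], hi⟩
  · rw [← hl ⟨g, hg, hgw⟩, wordSubst, List.map_flatMap]
    congr 2
    funext i
    rcases h : l.idxFun i with _ | y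
    · simpa [block, h, hg, Combinatorics.Line.coe_apply, wordSubst] using
        wordSubst_range' (a := a) (p := g)
    · simp only [block, h, Option.map_some, Option.getD_some, Combinatorics.Line.coe_apply]
      conv_rhs => rw [← List.map_id (y : List ℕ)]
      exact List.map_congr_left fun x hx => letterSubst_of_lt (y.2.2.lt_of_mem x hx)

/-- Colourings can be restricted so that the colour of a word whose first `j` letters contain `a`
only depends on the part before the first occurrence of `a`. -/
theorem exists_prefix_coloring {a t : ℕ}
    (ih : ∀ (m : ℕ) (κ : Type) [Finite κ], GrahamRothschild (a + 1) m t κ)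
    (κ : Type) [Finite κ] (j L : ℕ) :
    ∃ N, ∀ χ : List ℕ → κ, ∃ w : List ℕ, w.length = N ∧ RigidWord a (a + L) w ∧
      ∃ c : List ℕ → κ, ∀ p q : List ℕ, p.length < j → (p ++ a :: q).length = L →
        RigidWord a a p → RigidWord (a + 1) (a + 1 + t) q →
          χ (wordSubst a w (p ++ a :: q)) = c p := by
  induction j generalizing L with
  | zero =>
    exact ⟨L, fun χ => ⟨List.range' a L, by simp, .range' a L, fun _ => χ [], by simp⟩⟩
  | succ j ihj =>
    rcases le_or_gt L j with hLj | hLj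
    · obtain ⟨N, hN⟩ := ihj L
      refine ⟨N, fun χ => ?_⟩
      obtain ⟨w, hwN, hw, c, hc⟩ := hN χ
      refine ⟨w, hwN, hw, c, fun p q _ hpq => hc p q ?_ hpq⟩
      simp at hpq
      omega
    obtain ⟨M, rfl⟩ : ∃ M, L = j + 1 + M := ⟨L - (j + 1), by omega⟩
    have := finite_words a j
    obtain ⟨N₀, hN₀⟩ := ih M ({l : List ℕ // l.length = j ∧ RigidWord a a l} → κ)
    obtain ⟨N, hN⟩ := ihj (j + 1 + N₀)
    refine ⟨N, fun χ => ?_⟩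
    obtain ⟨w, hwN, hw, c, hc⟩ := hN χ
    obtain ⟨u, huN, hu, F, hF⟩ := hN₀ fun l p => χ (wordSubst a w (p ++ a :: l))
    let φ (x : ℕ) : ℕ := if x < a then x else x + j
    have hφu : RigidWord (a + j + 1) (a + (j + 1 + M)) (u.map φ) := by
      refine hu.map (fun x hx => ?_) ?_
      · simp only [φ]; split_ifs <;> omega
      · have : (List.range' (a + 1) (a + 1 + M - (a + 1))).map φ = List.range' (a + j + 1) M := by
          refine List.ext_getElem (by simp) fun n h₁ h₂ => ?_
          simp only [List.getElem_map, List.getElem_range', φ]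
          rw [if_neg (by omega)]
          omega
        rw [this]
        convert RigidWord.range' (a + j + 1) M using 1
        omega
    have hv : RigidWord a (a + (j + 1 + M)) (List.range' a (j + 1) ++ u.map φ) :=
      (RigidWord.range' a (j + 1)).append hφu
    have hvlen : (List.range' a (j + 1) ++ u.map φ).length = j + 1 + N₀ := by simp [huN]
    have hwv : ∀ x ∈ w, x < a + (List.range' a (j + 1) ++ u.map φ).length := by
      rw [hvlen]; exact hw.lt_of_mem
    refine ⟨wordSubst a w (List.range' a (j + 1) ++ u.map φ), by simpa using hwN,
      RigidWord.wordSubst (by rwa [hvlen]) hv,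
      fun p => if h : p.length = j ∧ RigidWord a a p then F ⟨p, h⟩ else c p,
      fun p q hpj hpq hp hq => ?_⟩
    beta_reduce
    rw [wordSubst_assoc hwv]
    rcases (Nat.lt_succ_iff.1 hpj).eq_or_lt with rfl | hlt
    · rw [dif_pos ⟨rfl, hp⟩]
      have hsub : wordSubst a (List.range' a (p.length + 1) ++ u.map φ) (p ++ a :: q) =
          p ++ a :: wordSubst (a + 1) u q := by
        have h₁ := wordSubst_range'_append (a := a) (p := p ++ [a]) (q := q)
        have h₂ : wordSubst a (u.map φ) (p ++ a :: q) = wordSubst (a + 1) u q := by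
          rw [wordSubst, List.map_map]
          refine List.map_congr_left fun x _ => ?_
          simp only [Function.comp_apply, φ]
          split_ifs with hx
          · rw [letterSubst_of_lt hx, letterSubst_of_lt (by omega)]
          · obtain ⟨i, rfl⟩ := Nat.exists_eq_add_of_le (not_lt.1 hx)
            rw [add_assoc, letterSubst_add, List.getD_append_right _ _ _ _ (by omega)]
            rcases i with _ | i
            · simp [letterSubst]
            · rw [show a + (i + 1) = a + 1 + i by omega, letterSubst_add]
              simp [show i + 1 + p.length - p.length = i + 1 by omega]
        simp only [List.append_assoc, List.singleton_append, List.length_append,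
          List.length_singleton] at h₁
        rw [wordSubst_append, h₁, h₂]
        simp
      rw [hsub]
      exact congrFun (hF q (by simp at hpq; omega) hq) ⟨p, rfl, hp⟩
    · rw [dif_neg (by omega)]
      have hsplit : List.range' a (j + 1) ++ u.map φ = List.range' a p.length ++
          (a + p.length) :: (List.range' (a + p.length + 1) (j - p.length) ++ u.map φ) := by
        rw [show j + 1 = p.length + ((j - p.length) + 1) by omega, ← List.range'_append_1,
          List.range'_succ]
        simp
      have htail : RigidWord (a + p.length + 1) (a + (p ++ a :: q).length)
          (List.range' (a + p.length + 1) (j - p.length) ++ u.map φ) := by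
        rw [hpq]
        refine RigidWord.append (.range' _ _) ?_
        rwa [show a + p.length + 1 + (j - p.length) = a + j + 1 by omega]
      obtain ⟨r, hr, hrw⟩ := exists_wordSubst_split (.range' a p.length) htail hp hq
      rw [wordSubst_range'] at hr
      have hrlen : (p ++ a :: r).length = j + 1 + N₀ := by
        rw [← hr, ← hsplit, length_wordSubst, hvlen]
      rw [hsplit, hr]
      exact hc p r hlt hrlen hp hrw

/-- For every colouring of words over a nonempty alphabet of size `a` there are a colour `k` and a
word with `f k` parameters all of whose initial parts preceding the first occurrence of a parameter
generate only words of colour `k`. -/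
theorem exists_monochromatic_prefixes {a : ℕ} (ha : 0 < a) {κ : Type} [Fintype κ] (f : κ → ℕ) :
    ∃ L, ∀ c : List ℕ → κ, ∃ (k : κ) (w : List ℕ), w.length ≤ L ∧ RigidWord a (a + f k) w ∧
      ∀ p : List ℕ, p.length < f k → RigidWord a a p →
        c (wordSubst a (w.takeWhile (· < a + p.length)) p) = k := by
  induction hn : ∑ k, f k using Nat.strong_induction_on generalizing f with
  | _ n ih =>
  by_cases hf : ∃ k, f k = 0
  · obtain ⟨k, hk⟩ := hf
    exact ⟨0, fun c => ⟨k, [], by simp, by simpa [hk] using .nil a, by simp [hk]⟩⟩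
  push Not at hf
  have hlt (k : κ) : ∑ i, Function.update f k (f k - 1) i < n := by
    rw [← hn]
    refine Finset.sum_lt_sum (fun i _ => ?_) ⟨k, Finset.mem_univ k, ?_⟩
    · rcases eq_or_ne i k with rfl | h
      · simp
      · simp [h]
    · have := hf k
      simp
      omega
  choose L hL using fun k => ih _ (hlt k) _ rfl
  obtain ⟨N, hN⟩ := grahamRothschild_zero a (∑ k, L k) κ
  refine ⟨N + 1, fun c => ?_⟩
  obtain ⟨v, hvN, hv, k₀, hk₀⟩ := hN c
  obtain ⟨k, w, hwL, hw, hwc⟩ := hL k₀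
    fun l => c (wordSubst a (v.takeWhile (· < a + l.length)) l)
  replace hwL := hwL.trans (Finset.single_le_sum (fun _ _ => Nat.zero_le _) (Finset.mem_univ k₀))
  let w' := w ++ List.replicate (∑ k, L k - w.length) 0
  have hw'len : w'.length = ∑ k, L k := by simp [w']; omega
  have hw' : RigidWord a (a + Function.update f k₀ (f k₀ - 1) k) w' := hw.append_zeros ha _
  have hvw' : RigidWord a (a + Function.update f k₀ (f k₀ - 1) k) (wordSubst a v w') :=
    RigidWord.wordSubst (by rwa [hw'len]) hw'
  have hcol (p : List ℕ) (r : List ℕ) (hpk : p.length < Function.update f k₀ (f k₀ - 1) k)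
      (hp : RigidWord a a p) :
      c (wordSubst a ((wordSubst a v w' ++ r).takeWhile (· < a + p.length)) p) = k := by
    obtain ⟨u₁, u₂, hu, hu₁, -⟩ :=
      hw.exists_split (x := a + p.length) (by omega) (by omega)
    have hlen : u₁.length < ∑ k, L k := by
      rw [hu] at hwL
      simp at hwL
      omega
    obtain ⟨v₁, v₂, hv', hv₁, -⟩ :=
      hv.exists_split (x := a + u₁.length) (by omega) (by omega)
    have hvw₁ : RigidWord a (a + p.length) (wordSubst a v₁ u₁) := hv₁.wordSubst hu₁
    have hdec : ∃ s, wordSubst a v w' ++ r = wordSubst a v₁ u₁ ++ (a + p.length) :: s := by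
      refine ⟨wordSubst a v₂ w' ++ r, ?_⟩
      have h₁ : wordSubst a v₁ w' = wordSubst a v₁ u₁ := by
        simp only [w', hu, List.append_assoc]
        exact wordSubst_append_right hv₁.lt_of_mem
      have h₂ : letterSubst a w' (a + u₁.length) = a + p.length := by
        simp [letterSubst_add, w', hu]
      rw [hv', wordSubst_append, h₁]
      simp [wordSubst, h₂]
    obtain ⟨s, hs⟩ := hdec
    have := hwc p hpk hp
    rw [hu, hu₁.takeWhile_append_cons, length_wordSubst, hv', hv₁.takeWhile_append_cons] at this
    rw [hs, hvw₁.takeWhile_append_cons, wordSubst_assoc hv₁.lt_of_mem, this]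
  rcases eq_or_ne k k₀ with rfl | hk
  · simp only [Function.update_self] at hw hw' hvw' hcol
    have hfk : a + f k = a + (f k - 1) + 1 := by have := hf k; omega
    refine ⟨k, wordSubst a v w' ++ [a + (f k - 1)], by simp [hvN], ?_, fun p hpk hp => ?_⟩
    · rw [hfk]
      exact hvw'.append (.new (.nil _))
    · rcases (show p.length ≤ f k - 1 by omega).lt_or_eq with h | h
      · exact hcol p _ h hp
      · rw [h, hvw'.takeWhile_append_cons, wordSubst_assoc (by rw [hw'len]; exact hv.lt_of_mem)]
        exact hk₀ _ (by simpa using hw'len) (RigidWord.wordSubst (by rwa [h]) hp)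
  · simp only [Function.update_of_ne hk] at hw hw' hvw' hcol
    refine ⟨k, wordSubst a v w', by simp [hvN], hvw', fun p hpk hp => ?_⟩
    simpa using hcol p [] hpk hp

/-- The Graham–Rothschild theorem. -/
theorem grahamRothschild (a m t : ℕ) (κ : Type) [Finite κ] : GrahamRothschild a m t κ := by
  induction t generalizing a m κ with
  | zero => exact grahamRothschild_zero a m κ
  | succ t ih =>
  have hst : a + (t + 1) = a + 1 + t := by omega
  have := Fintype.ofFinite κ
  rcases Nat.eq_zero_or_pos a with rfl | ha
  · obtain ⟨N, hN⟩ := exists_prefix_coloring (ih 1) κ m m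
    refine ⟨N, fun χ => ?_⟩
    obtain ⟨w, hwN, hw, c, hc⟩ := hN χ
    refine ⟨w, hwN, hw, c [], fun g hg hgw => ?_⟩
    obtain ⟨p, q, rfl, hp, hq⟩ := hgw.exists_split le_rfl (by omega)
    obtain rfl : p = [] :=
      List.eq_nil_iff_forall_not_mem.2 fun x hx => absurd (hp.lt_of_mem x hx) (by omega)
    rw [hst] at hq
    exact hc [] q (by simp at hg; simp; omega) hg hp hq
  · obtain ⟨L, hL⟩ := exists_monochromatic_prefixes ha fun _ : κ => m
    obtain ⟨N, hN⟩ := exists_prefix_coloring (ih (a + 1)) κ L L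
    refine ⟨N, fun χ => ?_⟩
    obtain ⟨w, hwN, hw, c, hc⟩ := hN χ
    obtain ⟨k, v, hvL, hv, hvc⟩ := hL c
    let v' := v ++ List.replicate (L - v.length) 0
    have hv'len : v'.length = L := by simp [v']; omega
    have hv' : RigidWord a (a + m) v' := hv.append_zeros ha _
    have hwv' : RigidWord a (a + v'.length) w := by rwa [hv'len]
    refine ⟨wordSubst a w v', by simpa using hwN, hwv'.wordSubst hv', k, fun g hg hgw => ?_⟩
    obtain ⟨p, q, rfl, hp, hq⟩ := hgw.exists_split le_rfl (by omega)
    rw [hst] at hq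
    have hpm : p.length < m := by simp at hg; omega
    obtain ⟨u₁, u₂, hu, hu₁, hu₂⟩ :=
      hv.exists_split (x := a + p.length) (by omega) (by omega)
    have hv'u : v' = u₁ ++ (a + p.length) :: (u₂ ++ List.replicate (L - v.length) 0) := by
      simp [v', hu]
    obtain ⟨r, hr, hrw⟩ := exists_wordSubst_split hu₁
      (by rw [hg]; exact hu₂.append_zeros (by omega) (L - v.length)) hp hq
    rw [← hv'u] at hr
    have hlen : (wordSubst a u₁ p ++ a :: r).length = L := by rw [← hr, length_wordSubst, hv'len]
    have := hvc p hpm hp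
    rw [hu, hu₁.takeWhile_append_cons] at this
    rw [wordSubst_assoc hwv'.lt_of_mem, hr,
      hc _ r (by rw [← hlen]; simp) hlen (hu₁.wordSubst hp) hrw, this]

theorem isRigidSurjection_iff {A B : Type*} [LinearOrder A] [Finite A] [LinearOrder B]
    {f : A → B} : IsRigidSurjection f ↔
      Function.Surjective f ∧ ∀ x y : B, x < y → ∀ b, f b = y → ∃ a < b, f a = x := by
  refine and_congr_right fun hf => ⟨fun h x y hxy b hb => ?_, fun h x y hxy a b ha hb => ?_⟩
  · have hleast (z : B) : ∃ a, IsLeast {u | f u = z} a := by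
      obtain ⟨a, ha, hmin⟩ := (Set.toFinite {u | f u = z}).exists_minimal (hf z)
      exact ⟨a, ha, fun u hu => (le_total a u).elim id fun hle => hmin hu hle⟩
    obtain ⟨a, ha⟩ := hleast x
    obtain ⟨b', hb'⟩ := hleast y
    exact ⟨a, (h x y hxy a b' ha hb').trans_le (hb'.2 hb), ha.1⟩
  · obtain ⟨a', ha', hx⟩ := h x y hxy b hb.1
    exact (ha.2 hx).trans_lt ha'

theorem IsRigidSurjection.rigidWord_ofFn {m t : ℕ} {f : Fin m → Fin t}
    (hf : IsRigidSurjection f) : RigidWord 0 t (List.ofFn fun i => (f i : ℕ)) := by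
  rw [isRigidSurjection_iff] at hf
  refine .of_first_occurrences t.zero_le (fun y _ hy => ?_) fun u x v huv => ?_
  · obtain ⟨i, hi⟩ := hf.1 ⟨y, hy⟩
    exact (List.mem_ofFn).2 ⟨i, by simp [hi]⟩
  · have hlen : u.length < m := by
      have := congrArg List.length huv
      simp at this
      omega
    have hval (i : ℕ) (hi : i < m) : (u ++ x :: v)[i]? = some (f ⟨i, hi⟩ : ℕ) := by
      rw [← huv]
      simp [hi]
    have hx : (f ⟨u.length, hlen⟩ : ℕ) = x := by
      have := hval u.length hlen
      simp at this
      exact this.symm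
    refine ⟨hx ▸ (f _).2, fun y _ hyx => ?_⟩
    obtain ⟨i, hi, hiy⟩ := hf.2 ⟨y, by omega⟩ _ (by rw [Fin.lt_def, hx]; exact hyx) _ rfl
    have := hval i i.2
    rw [List.getElem?_append_left hi, Fin.eta, hiy] at this
    exact List.mem_of_getElem? this

theorem RigidWord.isRigidSurjection {m n : ℕ} {w : List ℕ} (hw : RigidWord 0 m w)
    (hn : w.length ≤ n) {f : Fin n → Fin m} (hf : ∀ i, (f i : ℕ) = w.getD i 0) :
    IsRigidSurjection f := by
  rw [isRigidSurjection_iff]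
  refine ⟨fun y => ?_, fun x y hxy b hb => ?_⟩
  · obtain ⟨u, v, rfl, -, -⟩ := hw.exists_split (x := y) (Nat.zero_le _) y.2
    refine ⟨⟨u.length, by simp at hn; omega⟩, Fin.ext ?_⟩
    simp [hf]
  · obtain ⟨u, v, rfl, hu, -⟩ := hw.exists_split (x := y) (Nat.zero_le _) y.2
    have hub : u.length ≤ b := by
      by_contra! hlt
      have := hf b
      rw [hb, List.getD_append _ _ _ _ hlt, List.getD_eq_getElem _ _ hlt] at this
      have := hu.lt_of_mem _ (List.getElem_mem hlt)
      omega
    obtain ⟨u₁, u₂, rfl, -, -⟩ := hu.exists_split (x := x) (Nat.zero_le _) hxy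
    simp at hub
    refine ⟨⟨u₁.length, by omega⟩, by rw [Fin.lt_def]; simp; omega, Fin.ext ?_⟩
    simp [hf]

/-- The finite dual Ramsey theorem. -/
theorem exists_dualRamsey_fin (m t : ℕ) (κ : Type) [Finite κ] (hm : 0 < m)
    (ht : 0 < t) :
    ∃ N, ∀ n, N ≤ n → ∀ χ : (Fin n → Fin t) → κ, ∃ w : Fin n → Fin m, IsRigidSurjection w ∧
      ∃ i, ∀ g : Fin m → Fin t, IsRigidSurjection g → χ (g ∘ w) = i := by
  obtain ⟨N, hN⟩ := grahamRothschild 0 m t κ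
  refine ⟨N, fun n hn χ => ?_⟩
  obtain ⟨w, rfl, hw, i, hi⟩ := hN fun l =>
    χ fun x => ⟨l.getD x 0 % t, Nat.mod_lt _ ht⟩
  rw [zero_add] at hw
  have hwlt (x : ℕ) : w.getD x 0 < m := by
    rcases lt_or_ge x w.length with h | h
    · rw [List.getD_eq_getElem _ _ h]
      exact hw.lt_of_mem _ (List.getElem_mem h)
    · rwa [List.getD_eq_default _ _ h]
  refine ⟨fun x => ⟨w.getD x 0, hwlt x⟩, hw.isRigidSurjection hn fun _ => rfl, i,
    fun g hg => ?_⟩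
  have hgw := hg.rigidWord_ofFn
  rw [← hi (List.ofFn fun i => (g i : ℕ)) (by simp) (by simpa using hgw)]
  congr 1
  funext x
  have hg0 : (List.ofFn fun i => (g i : ℕ)).getD 0 0 = 0 := by
    obtain ⟨u, v, huv, hu, -⟩ := hgw.exists_split (x := 0) le_rfl ht
    have : u = [] :=
      List.eq_nil_iff_forall_not_mem.2 fun x hx => absurd (hu.lt_of_mem x hx) (by omega)
    rw [huv, this]
    simp
  have key : (wordSubst 0 w (List.ofFn fun i => (g i : ℕ))).getD x 0 =
      (List.ofFn fun i => (g i : ℕ)).getD (w.getD x 0) 0 := by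
    have h := List.getD_map (l := w) (d := 0) (n := x) (letterSubst 0 (List.ofFn fun i => (g i : ℕ)))
    have h₀ (y : ℕ) := letterSubst_add (a := 0) (g := List.ofFn fun i => (g i : ℕ)) y
    simp only [zero_add] at h₀
    rwa [h₀, h₀, hg0] at h
  have hgx : (List.ofFn fun i => (g i : ℕ)).getD (w.getD x 0) 0 = g ⟨w.getD x 0, hwlt x⟩ := by
    rw [List.getD_eq_getElem _ _ (by simpa using hwlt x), List.getElem_ofFn]
  refine Fin.ext ?_
  simp only [Function.comp_apply, key, hgx, Nat.mod_eq_of_lt (g _).2]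

theorem IsRigidSurjection.orderIso_comp {A B C : Type*} [LinearOrder A] [Finite A] [LinearOrder B]
    [LinearOrder C] {f : A → B} (hf : IsRigidSurjection f) (e : B ≃o C) :
    IsRigidSurjection (e ∘ f) := by
  rw [isRigidSurjection_iff] at hf ⊢
  refine ⟨e.surjective.comp hf.1, fun x y hxy b hb => ?_⟩
  obtain ⟨a, hab, ha⟩ := hf.2 (e.symm x) (e.symm y) (by simpa using hxy) b (by simp [← hb])
  exact ⟨a, hab, by simp [ha]⟩

theorem IsRigidSurjection.comp_orderIso {A B C : Type*} [LinearOrder A] [Finite A] [LinearOrder B]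
    [Finite B] [LinearOrder C] {f : B → C} (hf : IsRigidSurjection f) (e : A ≃o B) :
    IsRigidSurjection (f ∘ e) := by
  rw [isRigidSurjection_iff] at hf ⊢
  refine ⟨hf.1.comp e.surjective, fun x y hxy b hb => ?_⟩
  obtain ⟨a, hab, ha⟩ := hf.2 x y hxy (e b) hb
  exact ⟨e.symm a, by rwa [e.symm_apply_lt], by simp [ha]⟩

theorem isRSH_id (M : OBinObj) : IsRSH M M id :=
  ⟨fun _ _ h => h, isRigidSurjection_iff.2
    ⟨Function.surjective_id, fun x _ hxy _ hb => ⟨x, hxy.trans_eq hb.symm, rfl⟩⟩⟩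

theorem isRSH_estruct {n : ℕ} {M : OBinObj} {w : Fin n → M.carrier} (hw : IsRigidSurjection w) :
    IsRSH (Estruct n) M w := by
  refine ⟨fun x y hxy => ?_, hw⟩
  obtain rfl : x = y := hxy
  exact M.refl _

/-- Proposition 4.1. Every full subcategory `C` of `OBin_rsh` whose
class of objects contains an infinite subsequence of `E₁, E₂, E₃, …` has the dual
Ramsey property. -/
theorem stmt9 (S : Set OBinObj) (h : ∀ m : ℕ, ∃ n : ℕ, m < n ∧ Estruct n ∈ S) :
    HasDualRamseySub (fun M : OBinObj => M.carrier) IsRSH S := by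
  intro k _ A hA B hB ⟨f, hf⟩
  rcases isEmpty_or_nonempty B.carrier with hBe | hBn
  · have (g₁ g₂ : B.carrier → A.carrier) : g₁ = g₂ := Subsingleton.elim _ _
    exact ⟨B, hB, fun χ => ⟨id, isRSH_id B, χ f, fun g _ => congrArg χ (this _ _)⟩⟩
  have hAn : Nonempty A.carrier := hBn.map f
  let eA : Fin (Fintype.card A.carrier) ≃o A.carrier := Fintype.orderIsoFinOfCardEq _ rfl
  let eB : Fin (Fintype.card B.carrier) ≃o B.carrier := Fintype.orderIsoFinOfCardEq _ rfl
  obtain ⟨N, hN⟩ := exists_dualRamsey_fin (Fintype.card B.carrier) (Fintype.card A.carrier) (Fin k)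
    Fintype.card_pos Fintype.card_pos
  obtain ⟨n, hNn, hn⟩ := h N
  refine ⟨Estruct n, hn, fun χ => ?_⟩
  obtain ⟨w, hw, i, hi⟩ := hN n hNn.le fun u => χ (eA ∘ u)
  refine ⟨eB ∘ w, isRSH_estruct (hw.orderIso_comp eB), i, fun g hg => ?_⟩
  rw [← hi (eA.symm ∘ g ∘ eB) ((hg.2.comp_orderIso eB).orderIso_comp eA.symm)]
  congr 1
  funext x
  exact (eA.apply_symm_apply (g (eB (w x)))).symm
end
end

section
/- Let A = (A, ρ, ⊏) and A' = (A', ρ', ⊏') be two finite linearly ordered reflexive relational structures where ρ ⊆ Aʳ, ρ' ⊆ (A')ʳ and r ≥ 2, and let f : (A,ρ) → (A',ρ') be a homomorphism; define f̂ : ρ → ρ' coordinatewise. For every u ∈ A', if f̂⁻¹(u,u,…,u) ≠ ∅ then min f̂⁻¹(u,u,…,u) = (x,x,…,x), where x = min f⁻¹(u) and the minimum over f̂⁻¹ is taken with respect to the special anti-lexicographic order ⊏_sal. -/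
open scoped Classical

theorem mem_classOf_tpRel_self {A : Type*} [LinearOrder A] (l : List A) {i : ℕ}
    (hi : i < l.length) : i ∈ classOf (tpRel l) l.length i := by
  exact Finset.mem_filter.mpr
    ⟨Finset.mem_range.mpr hi, ⟨hi, hi, le_rfl⟩, ⟨hi, hi, le_rfl⟩⟩

theorem range_mem_classesOf_tpRel {A : Type*} [LinearOrder A] (l : List A)
    (h : (classesOf (tpRel l) l.length).card = 1) :
    Finset.range l.length ∈ classesOf (tpRel l) l.length := by
  obtain ⟨C, hC⟩ := Finset.card_eq_one.mp h
  have key : ∀ i < l.length, classOf (tpRel l) l.length i = C := fun i hi =>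
    Finset.mem_singleton.mp (hC ▸ Finset.mem_image_of_mem _ (Finset.mem_range.mpr hi))
  have hCmem : C ∈ classesOf (tpRel l) l.length := by simp [hC]
  obtain ⟨i, -, hi⟩ := Finset.mem_image.mp hCmem
  convert hCmem
  refine Finset.Subset.antisymm (fun j hj => ?_) (hi ▸ Finset.filter_subset _ _)
  have hj' := Finset.mem_range.mp hj
  exact key j hj' ▸ mem_classOf_tpRel_self l hj'

theorem classesOf_tpRel_replicate {A : Type*} [LinearOrder A] {r : ℕ} (hr : 0 < r) (x : A) :
    classesOf (tpRel (List.replicate r x)) r = {Finset.range r} := by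
  have key : ∀ i < r, classOf (tpRel (List.replicate r x)) r i = Finset.range r := by
    intro i hi
    refine Finset.filter_true_of_mem fun j hj => ?_
    have hj' := Finset.mem_range.mp hj
    simp [tpRel, hi, hj']
  ext M
  simp only [classesOf, Finset.mem_image, Finset.mem_range, Finset.mem_singleton]
  constructor
  · rintro ⟨i, hi, rfl⟩
    exact key i hi
  · rintro rfl
    exact ⟨0, hr, key 0 hr⟩

theorem not_quasiLT_tpRel_replicate {A : Type*} [LinearOrder A] (l : List A)
    (hl : 0 < l.length) (x : A) :
    ¬ quasiLT l.length (tpRel l) (tpRel (List.replicate l.length x)) := by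
  rintro (h | ⟨h, M, hM, hM', -⟩)
  · rw [classesOf_tpRel_replicate hl, Finset.card_singleton, Nat.lt_one_iff,
      Finset.card_eq_zero, classesOf, Finset.image_eq_empty, Finset.range_eq_empty_iff] at h
    omega
  · rw [classesOf_tpRel_replicate hl] at h hM
    rw [Finset.mem_singleton.mp hM] at hM'
    exact hM' (range_mem_classesOf_tpRel l (by simpa using h))

theorem not_salLT_replicate {A : Type*} [LinearOrder A] {r : ℕ} (hr : 0 < r) {l : List A}
    {x : A} (hx : ∀ a ∈ l, x ≤ a) : ¬ salLT l (List.replicate r x) := by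
  rintro ⟨hlen, h⟩
  rw [List.length_replicate] at hlen
  subst hlen
  rcases h with h | ⟨-, -, y, hy, hy', hyz⟩
  · exact not_quasiLT_tpRel_replicate l hr x h
  · obtain ⟨a, ha⟩ := List.exists_mem_of_length_pos hr
    have hyx : y = x := List.eq_of_mem_replicate (List.mem_toFinset.mp hy)
    subst hyx
    have hne : y ≠ a := fun e => hy' (List.mem_toFinset.mpr (e ▸ ha))
    have hmem := (hyz a (lt_of_le_of_ne (hx a ha) hne)).mp (List.mem_toFinset.mpr ha)
    exact hne (List.eq_of_mem_replicate (List.mem_toFinset.mp hmem)).symm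

/-- Lemma 5.3 (a). Let `(A,ρ,⊏)`, `(A',ρ',⊏')` be finite linearly
ordered reflexive relational structures, `ρ ⊆ Aʳ`, `ρ' ⊆ (A')ʳ`, `r ≥ 2` (tuples
represented as lists of length `r`), and let `f` be a homomorphism. For every
`u ∈ A'`, if `f̂⁻¹(u,…,u) ≠ ∅` then `min f̂⁻¹(u,…,u) = (x,…,x)` where
`x = min f⁻¹(u)` (the first minimum taken w.r.t. `⊏_sal`). -/
theorem stmt11 {A B : Type*} [Fintype A] [LinearOrder A] [Fintype B] [LinearOrder B]
    (r : ℕ) (hr : 2 ≤ r)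
    (ρ : Set (List A)) (hlen : ∀ l ∈ ρ, l.length = r)
    (hrefl : ∀ a : A, List.replicate r a ∈ ρ)
    (ρ' : Set (List B)) (hlen' : ∀ l ∈ ρ', l.length = r)
    (hrefl' : ∀ b : B, List.replicate r b ∈ ρ')
    (f : A → B) (hhom : ∀ l ∈ ρ, l.map f ∈ ρ')
    (u : B) (m : List A)
    (hm : MinWrt salLT {l | l ∈ ρ ∧ l.map f = List.replicate r u} m)
    (x : A) (hx : IsLeast {a | f a = u} x) :
    m = List.replicate r x := by
  refine (hm.2 (List.replicate r x) ⟨hrefl x, ?_⟩).elim Eq.symm fun h => ?_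
  · rw [List.map_replicate, hx.1]
  · refine absurd h (not_salLT_replicate (by omega) fun a ha => hx.2 ?_)
    exact List.eq_of_mem_replicate (hm.1.2 ▸ List.mem_map_of_mem ha)
end

section
/- Let A = (A, ρ, ⊏) and A' = (A', ρ', ⊏') be two finite linearly ordered reflexive relational structures where ρ ⊆ Aʳ, ρ' ⊆ (A')ʳ and r ≥ 2, and let f : (A,ρ) → (A',ρ') be a homomorphism. If f̂ : (ρ, ⊏_sal) → (ρ', ⊏'_sal) is a rigid surjection, then f is a rigid surjection (A,⊏) → (A',⊏') and a quotient map (A,ρ) → (A',ρ') (i.e., f is surjective and for every (b₁,…,b_r) ∈ ρ' there exists (a₁,…,a_r) ∈ ρ with f(a_i) = b_i for all i). -/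
open scoped Classical

theorem tpRel_replicate {A : Type*} [LinearOrder A] (r : ℕ) (a : A) :
    tpRel (List.replicate r a) = fun i j => i < r ∧ j < r := by
  funext i j
  simp [tpRel]

theorem altLex_singleton {A : Type*} [LinearOrder A] {a b : A} :
    altLex {a} {b} ↔ a < b := by
  constructor
  · rintro ⟨m, hm, hma, h⟩
    rw [Finset.mem_singleton] at hm hma
    subst hm
    by_contra! hle
    have hlt : m < a := lt_of_le_of_ne hle hma
    exact hma (Finset.mem_singleton.1 ((h a hlt).1 (Finset.mem_singleton_self a))).symm
  · intro h
    refine ⟨b, by simp, by simpa using h.ne', fun z hz => ?_⟩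
    simp [hz.ne', (h.trans hz).ne']

theorem salLT_replicate_iff {A : Type*} [LinearOrder A] {r : ℕ} (hr : r ≠ 0) (a b : A) :
    salLT (List.replicate r a) (List.replicate r b) ↔ a < b := by
  unfold salLT
  rw [List.toFinset_replicate_of_ne_zero hr, List.toFinset_replicate_of_ne_zero hr,
    tpRel_replicate, tpRel_replicate, altLex_singleton]
  simp only [List.length_replicate, not_quasiLT_self, false_or, true_and]
  exact ⟨fun h => h.2, fun h => ⟨fun e => h.ne (Finset.singleton_injective e), h⟩⟩

theorem card_classesOf_replicate_le {A : Type*} [LinearOrder A] (r : ℕ) (a : A) :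
    (classesOf (tpRel (List.replicate r a)) r).card ≤ 1 := by
  rw [Finset.card_le_one, tpRel_replicate]
  have key : ∀ i ∈ Finset.range r,
      classOf (fun i j => i < r ∧ j < r) r i = Finset.range r := by
    intro i hi
    rw [Finset.mem_range] at hi
    ext j
    simp only [classOf, Finset.mem_filter, Finset.mem_range]
    tauto
  intro X hX Y hY
  obtain ⟨i, hi, rfl⟩ := Finset.mem_image.1 hX
  obtain ⟨j, hj, rfl⟩ := Finset.mem_image.1 hY
  rw [key i hi, key j hj]

theorem one_lt_card_classesOf {A : Type*} [LinearOrder A] {l : List A} {i j : ℕ}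
    (hi : i < l.length) (hj : j < l.length) (hij : l[i] ≠ l[j]) :
    1 < (classesOf (tpRel l) l.length).card := by
  refine Finset.one_lt_card.2 ⟨_, Finset.mem_image_of_mem _ (Finset.mem_range.2 hi),
    _, Finset.mem_image_of_mem _ (Finset.mem_range.2 hj), fun h => hij ?_⟩
  have hmem : j ∈ classOf (tpRel l) l.length j :=
    Finset.mem_filter.2 ⟨Finset.mem_range.2 hj, ⟨hj, hj, le_rfl⟩, hj, hj, le_rfl⟩
  rw [← h] at hmem
  obtain ⟨-, ⟨_, _, hle⟩, _, _, hge⟩ := Finset.mem_filter.1 hmem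
  exact le_antisymm hle hge

theorem salLT_replicate_of_ne {A : Type*} [LinearOrder A] {l : List A} {i j : ℕ}
    (hi : i < l.length) (hj : j < l.length) (hij : l[i] ≠ l[j]) (a : A) :
    salLT (List.replicate l.length a) l := by
  refine ⟨List.length_replicate, Or.inl (Or.inl ?_)⟩
  rw [List.length_replicate]
  exact (card_classesOf_replicate_le _ a).trans_lt (one_lt_card_classesOf hi hj hij)

/-- The constant tuple at the least element of a fibre of `f` is the `⊏_sal`-least tuple
mapped to the corresponding constant tuple. -/
theorem minWrt_replicate {A B : Type*} [LinearOrder A] {r : ℕ} (hr : r ≠ 0)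
    {ρ : Set (List A)} (hrefl : ∀ a : A, List.replicate r a ∈ ρ) {f : A → B} {x : B} {a : A}
    (ha : IsLeast {u | f u = x} a) :
    MinWrt salLT {u | u ∈ ρ ∧ List.map f u = List.replicate r x} (List.replicate r a) := by
  have hfa : f a = x := ha.1
  refine ⟨⟨hrefl a, by rw [List.map_replicate, hfa]⟩, ?_⟩
  rintro u ⟨-, hu⟩
  have hlen : u.length = r := by simpa using congrArg List.length hu
  have hpos : 0 < u.length := by omega
  by_cases hconst : ∀ c ∈ u, c = u[0]
  · have hrep : u = List.replicate r u[0] := List.eq_replicate_iff.2 ⟨hlen, hconst⟩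
    have hfu : f u[0] = x := by
      have : f u[0] ∈ List.map f u := List.mem_map_of_mem (List.getElem_mem hpos)
      rw [hu] at this
      exact List.eq_of_mem_replicate this
    rcases (ha.2 hfu).eq_or_lt with h | h
    · exact Or.inl (hrep.trans (by rw [← h]))
    · right
      rw [hrep]
      exact (salLT_replicate_iff hr _ _).2 h
  · push Not at hconst
    obtain ⟨c, hc, hne⟩ := hconst
    obtain ⟨i, hi, rfl⟩ := List.getElem_of_mem hc
    right
    rw [← hlen]
    exact salLT_replicate_of_ne hi hpos hne a

/-- Lemma 5.3 (b). Let `(A,ρ,⊏)`, `(A',ρ',⊏')` be finite linearly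
ordered reflexive relational structures, `ρ ⊆ Aʳ`, `ρ' ⊆ (A')ʳ`, `r ≥ 2` (tuples
represented as lists of length `r`), and let `f` be a homomorphism. If
`f̂ : (ρ,⊏_sal) → (ρ',⊏'_sal)` is a rigid surjection then `f` is a rigid surjection
`(A,⊏) → (A',⊏')` and a quotient map `(A,ρ) → (A',ρ')`. -/
theorem stmt12 {A B : Type*} [Fintype A] [LinearOrder A] [Fintype B] [LinearOrder B]
    (r : ℕ) (hr : 2 ≤ r)
    (ρ : Set (List A)) (hlen : ∀ l ∈ ρ, l.length = r)
    (hrefl : ∀ a : A, List.replicate r a ∈ ρ)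
    (ρ' : Set (List B)) (hlen' : ∀ l ∈ ρ', l.length = r)
    (hrefl' : ∀ b : B, List.replicate r b ∈ ρ')
    (f : A → B) (hhom : ∀ l ∈ ρ, l.map f ∈ ρ')
    (hrs : IsRigidSurjOn salLT salLT ρ ρ' (List.map f)) :
    IsRigidSurjection f ∧
      (Function.Surjective f ∧ ∀ p ∈ ρ', ∃ l ∈ ρ, l.map f = p) := by
  have hr0 : r ≠ 0 := by omega
  obtain ⟨-, hsurj, hrigid⟩ := hrs
  have hfsurj : Function.Surjective f := by
    intro b
    obtain ⟨l, -, hl⟩ := hsurj _ (hrefl' b)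
    have hb : b ∈ List.map f l := by
      rw [hl]
      exact List.mem_replicate.2 ⟨hr0, rfl⟩
    obtain ⟨a, -, ha⟩ := List.mem_map.1 hb
    exact ⟨a, ha⟩
  refine ⟨⟨hfsurj, fun x y hxy a b ha hb => ?_⟩, hfsurj, hsurj⟩
  exact (salLT_replicate_iff hr0 a b).1
    (hrigid _ (hrefl' x) _ (hrefl' y) ((salLT_replicate_iff hr0 x y).2 hxy) _ _
      (minWrt_replicate hr0 hrefl ha) (minWrt_replicate hr0 hrefl hb))
end
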